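/- Let r, s be positive integers with r ≤ s, and let H be an r-graph on n vertices with matching number ν(H) ≤ s − r + 1. If n ≥ 4(s−r+1)(e·r)^{s−r+2} (where e is Euler's number), then K_s^r(H) ≤ K_s^r(F^{(r)}_{n,s−r+1,1}). -/

import Mathlib

open Finset

/-- The number of `s`-cliques of the `r`-uniform hypergraph `H`
(sets of `s` vertices all of whose `r`-element subsets are edges). -/
def cliqueCount {V : Type*} [Fintype V] [DecidableEq V] (r s : ℕ)
    (H : Finset (Finset V)) : ℕ :=
  ((Finset.univ.powersetCard s).filter (fun S => S.powersetCard r ⊆ H)).card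

/-- The hypergraph `F^{(r)}_{n,k,a}` on `Fin n`: all `r`-element subsets having
at least `a` elements among the first `a*k + a - 1` vertices. -/
def Fnka (n k r a : ℕ) : Finset (Finset (Fin n)) :=
  (Finset.univ.powersetCard r).filter
    (fun E => a ≤ (E.filter (fun x : Fin n => (x : ℕ) < a * k + a - 1)).card)

/-- The matching number of `H` is at most `k`. -/
def matchingLE {V : Type*} (H : Finset (Finset V)) (k : ℕ) : Prop :=
  ∀ M ⊆ H, (M : Set (Finset V)).Pairwise Disjoint → M.card ≤ k

/-- The degree of a vertex set `A`: the number of edges of `H` containing `A`. -/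
def degOf {V : Type*} [DecidableEq V] (H : Finset (Finset V)) (A : Finset V) : ℕ :=
  (H.filter (fun E => A ⊆ E)).card

/-- The shifting operator `S_{ij}` applied to a single edge. -/
def shiftEdge {n : ℕ} (H : Finset (Finset (Fin n))) (i j : Fin n)
    (E : Finset (Fin n)) : Finset (Fin n) :=
  if j ∈ E ∧ i ∉ E ∧ insert i (E.erase j) ∉ H then insert i (E.erase j) else E

/-- The shifted hypergraph `S_{ij}(H)`. -/
def shift {n : ℕ} (H : Finset (Finset (Fin n))) (i j : Fin n) :
    Finset (Finset (Fin n)) :=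
  H.image (shiftEdge H i j)

/-- `H` is stable if it is invariant under all shifts `S_{ij}` with `i < j`. -/
def IsStable {n : ℕ} (H : Finset (Finset (Fin n))) : Prop :=
  ∀ i j : Fin n, i < j → shift H i j = H

/-! ### Counting supersets -/

/-- The number of `s`-element supersets of `A`. -/
theorem card_powersetCard_filter_superset {V : Type*} [Fintype V] [DecidableEq V]
    (A : Finset V) {s : ℕ} (hs : A.card ≤ s) :
    ((univ.powersetCard s).filter (fun S => A ⊆ S)).card
      = (Fintype.card V - A.card).choose (s - A.card) := by
  rw [← card_compl, ← card_powersetCard]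
  refine card_bij' (fun S _ => S \ A) (fun R _ => R ∪ A) ?_ ?_ ?_ ?_
  · intro S hS
    simp only [mem_filter, mem_powersetCard, subset_univ, true_and] at hS ⊢
    refine ⟨fun x hx => by simp at hx ⊢; exact hx.2, ?_⟩
    rw [card_sdiff_of_subset hS.2, hS.1]
  · intro R hR
    simp only [mem_filter, mem_powersetCard, subset_univ, true_and] at hR ⊢
    refine ⟨?_, subset_union_right⟩
    rw [card_union_of_disjoint (disjoint_left.2 fun x hx hA => by
      simpa [hA] using hR.1 hx), hR.2]
    omega
  · intro S hS
    simp only [mem_filter] at hS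
    exact sdiff_union_of_subset hS.2
  · intro R hR
    simp only [mem_powersetCard] at hR
    exact union_sdiff_cancel_right (disjoint_left.2 fun x hx hA => by
      simpa [hA] using hR.1 hx)

/-- A union bound for the number of `s`-sets meeting `D` in at least `t` points. -/
theorem card_powersetCard_filter_inter_le {V : Type*} [Fintype V] [DecidableEq V]
    (D : Finset V) {s t : ℕ} (ht : t ≤ s) :
    ((univ.powersetCard s).filter (fun S => t ≤ (S ∩ D).card)).card
      ≤ D.card.choose t * (Fintype.card V - t).choose (s - t) := by
  have hsub : (univ.powersetCard s).filter (fun S => t ≤ (S ∩ D).card) ⊆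
      (D.powersetCard t).biUnion
        (fun A => (univ.powersetCard s).filter (fun S => A ⊆ S)) := by
    intro S hS
    rw [mem_filter] at hS
    obtain ⟨A, hA, hAt⟩ := exists_subset_card_eq hS.2
    exact mem_biUnion.2 ⟨A, mem_powersetCard.2 ⟨hA.trans inter_subset_right, hAt⟩,
      mem_filter.2 ⟨hS.1, hA.trans inter_subset_left⟩⟩
  refine (card_le_card hsub).trans ?_
  rw [← card_powersetCard]
  refine card_biUnion_le_card_mul _ _ _ fun A hA => ?_
  have hAt := (mem_powersetCard.1 hA).2
  rw [card_powersetCard_filter_superset A (hAt ▸ ht), hAt]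

/-! ### Cliques and compressions -/

/-- The family of `s`-cliques of `H`. -/
def cliques {V : Type*} [Fintype V] [DecidableEq V] (r s : ℕ) (H : Finset (Finset V)) :
    Finset (Finset V) :=
  (univ.powersetCard s).filter (fun S => S.powersetCard r ⊆ H)

theorem mem_cliques {V : Type*} [Fintype V] [DecidableEq V] {r s : ℕ}
    {H : Finset (Finset V)} {S : Finset V} :
    S ∈ cliques r s H ↔ S.card = s ∧ ∀ E ⊆ S, E.card = r → E ∈ H := by
  simp only [cliques, mem_filter, mem_powersetCard, subset_univ, true_and]
  refine and_congr_right fun _ => ⟨fun h E hE hr => h (mem_powersetCard.2 ⟨hE, hr⟩),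
    fun h E hE => h E (mem_powersetCard.1 hE).1 (mem_powersetCard.1 hE).2⟩

section Compression

variable {V : Type*} [DecidableEq V]

/-- The image of a set under the transposition of `i` and `j`. -/
def swapSet (i j : V) (E : Finset V) : Finset V := E.map (Equiv.swap i j).toEmbedding

theorem mem_swapSet {i j x : V} {E : Finset V} :
    x ∈ swapSet i j E ↔ Equiv.swap i j x ∈ E := by
  simp only [swapSet, mem_map_equiv, Equiv.symm_swap]

@[simp]
theorem swapSet_swapSet (i j : V) (E : Finset V) : swapSet i j (swapSet i j E) = E := by
  ext x; simp [mem_swapSet]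

@[simp]
theorem card_swapSet (i j : V) (E : Finset V) : (swapSet i j E).card = E.card :=
  card_map _

theorem swapSet_subset_swapSet {i j : V} {E F : Finset V} (h : E ⊆ F) :
    swapSet i j E ⊆ swapSet i j F :=
  map_subset_map.2 h

theorem swapSet_eq_self {i j : V} {E : Finset V} (h : i ∈ E ↔ j ∈ E) :
    swapSet i j E = E := by
  ext x
  rw [mem_swapSet]
  by_cases hi : x = i
  · subst hi; rw [Equiv.swap_apply_left]; exact h.symm
  by_cases hj : x = j
  · subst hj; rw [Equiv.swap_apply_right]; exact h
  rw [Equiv.swap_apply_of_ne_of_ne hi hj]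

theorem swapSet_of_mem_of_notMem {i j : V} {E : Finset V} (hj : j ∈ E) (hi : i ∉ E) :
    swapSet i j E = insert i (E.erase j) := by
  ext x
  have hij : i ≠ j := fun h => hi (h ▸ hj)
  rw [mem_swapSet, mem_insert, mem_erase]
  by_cases hxi : x = i
  · subst hxi; simp [hj]
  by_cases hxj : x = j
  · subst hxj; simp [hi, hxi]
  simp [Equiv.swap_apply_of_ne_of_ne hxi hxj, hxi, hxj]

variable [Fintype V]

/-- The compression of `H` replacing `j` by `i` wherever possible. -/
def compress (i j : V) (H : Finset (Finset V)) : Finset (Finset V) :=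
  univ.filter fun E =>
    if i ∈ E ∧ j ∉ E then E ∈ H ∨ swapSet i j E ∈ H else E ∈ H ∧ swapSet i j E ∈ H

theorem mem_compress {i j : V} {H : Finset (Finset V)} {E : Finset V} :
    E ∈ compress i j H ↔
      if i ∈ E ∧ j ∉ E then E ∈ H ∨ swapSet i j E ∈ H else E ∈ H ∧ swapSet i j E ∈ H := by
  simp [compress]

/-- The edge of `compress i j H` that an edge of `H` is moved to. -/
def compressEdge (i j : V) (H : Finset (Finset V)) (E : Finset V) : Finset V :=
  if E ∈ compress i j H then E else swapSet i j E

theorem of_mem_of_notMem_compress {i j : V} {H : Finset (Finset V)} {E : Finset V}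
    (hE : E ∈ H) (hE' : E ∉ compress i j H) : j ∈ E ∧ i ∉ E ∧ swapSet i j E ∉ H := by
  rw [mem_compress] at hE'
  split_ifs at hE' with h
  · exact absurd (Or.inl hE) hE'
  · have hs : swapSet i j E ∉ H := fun hs => hE' ⟨hE, hs⟩
    have hne : ¬(i ∈ E ↔ j ∈ E) := fun hiff => hs (by rwa [swapSet_eq_self hiff])
    tauto

theorem compressEdge_mem {i j : V} {H : Finset (Finset V)} {E : Finset V} (hE : E ∈ H) :
    compressEdge i j H E ∈ compress i j H := by
  unfold compressEdge
  split_ifs with h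
  · exact h
  · obtain ⟨hj, hi, -⟩ := of_mem_of_notMem_compress hE h
    rw [mem_compress, if_pos ⟨by simpa [mem_swapSet] using hj, by simpa [mem_swapSet] using hi⟩]
    exact Or.inr (by simpa using hE)

theorem compressEdge_injOn (i j : V) (H : Finset (Finset V)) :
    Set.InjOn (compressEdge i j H) H := by
  intro E hE F hF hEF
  unfold compressEdge at hEF
  split_ifs at hEF with h₁ h₂ h₂
  · exact hEF
  · exact absurd (hEF ▸ hE) (of_mem_of_notMem_compress hF h₂).2.2
  · exact absurd (hEF ▸ hF) (of_mem_of_notMem_compress hE h₁).2.2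
  · simpa using congrArg (swapSet i j) hEF

theorem card_le_card_compress (i j : V) (H : Finset (Finset V)) :
    H.card ≤ (compress i j H).card :=
  card_le_card_of_injOn _ (fun _ => compressEdge_mem) (compressEdge_injOn i j H)

theorem compress_subset_image (i j : V) (H : Finset (Finset V)) :
    compress i j H ⊆ H.image (compressEdge i j H) := by
  intro E hE
  rw [mem_image]
  by_cases hEH : E ∈ H
  · exact ⟨E, hEH, if_pos hE⟩
  · have hE' := mem_compress.1 hE
    split_ifs at hE' with h
    · refine ⟨swapSet i j E, hE'.resolve_left hEH, ?_⟩
      rw [compressEdge, if_neg, swapSet_swapSet]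
      rw [mem_compress, if_neg (by simp [mem_swapSet, h])]
      simp [hEH]
    · exact absurd hE'.1 hEH

theorem card_of_mem_compress {i j : V} {H : Finset (Finset V)} {r : ℕ}
    (hH : ∀ E ∈ H, E.card = r) : ∀ E ∈ compress i j H, E.card = r := by
  intro E hE
  rw [mem_compress] at hE
  split_ifs at hE
  · rcases hE with h | h
    · exact hH _ h
    · simpa using hH _ h
  · exact hH _ hE.1

theorem compress_cliques_subset (i j : V) (r s : ℕ) (H : Finset (Finset V)) :
    compress i j (cliques r s H) ⊆ cliques r s (compress i j H) := by
  intro S hS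
  have hcard : S.card = s := card_of_mem_compress (fun E hE => (mem_cliques.1 hE).1) S hS
  refine mem_cliques.2 ⟨hcard, fun E hES hEr => ?_⟩
  have hsub : swapSet i j E ⊆ swapSet i j S := swapSet_subset_swapSet hES
  rw [mem_compress] at hS ⊢
  by_cases hij : i ∈ S ∧ j ∉ S
  · rw [if_pos hij] at hS
    have hjE : j ∉ E := fun h => hij.2 (hES h)
    by_cases hiE : i ∈ E
    · rw [if_pos ⟨hiE, hjE⟩]
      exact hS.imp (fun h => (mem_cliques.1 h).2 E hES hEr)
        (fun h => (mem_cliques.1 h).2 _ hsub (by simpa using hEr))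
    · rw [if_neg (fun h => hiE h.1)]
      have hfix : swapSet i j E = E := swapSet_eq_self (by tauto)
      rw [hfix] at hsub ⊢
      have hEH : E ∈ H := hS.elim (fun h => (mem_cliques.1 h).2 E hES hEr)
        (fun h => (mem_cliques.1 h).2 _ hsub hEr)
      exact ⟨hEH, hEH⟩
  · rw [if_neg hij] at hS
    have h₁ : E ∈ H := (mem_cliques.1 hS.1).2 E hES hEr
    have h₂ : swapSet i j E ∈ H := (mem_cliques.1 hS.2).2 _ hsub (by simpa using hEr)
    split_ifs
    · exact Or.inl h₁
    · exact ⟨h₁, h₂⟩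

theorem card_cliques_le_compress (i j : V) (r s : ℕ) (H : Finset (Finset V)) :
    (cliques r s H).card ≤ (cliques r s (compress i j H)).card :=
  (card_le_card_compress i j _).trans (card_le_card (compress_cliques_subset i j r s H))

theorem matchingLE_compress {i j : V} {H : Finset (Finset V)} {k : ℕ}
    (hH : matchingLE H k) : matchingLE (compress i j H) k := by
  intro M hM hdisj
  by_cases hMH : M ⊆ H
  · exact hH M hMH hdisj
  obtain ⟨E₀, hE₀M, hE₀H⟩ := not_subset.1 hMH
  have hE₀ := mem_compress.1 (hM hE₀M)
  split_ifs at hE₀ with hij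
  swap
  · exact absurd hE₀.1 hE₀H
  have hinj : Function.Injective (swapSet i j) :=
    Function.LeftInverse.injective (swapSet_swapSet i j)
  rw [← card_image_of_injective M hinj]
  apply hH
  · intro F hF
    obtain ⟨E, hE, rfl⟩ := mem_image.1 hF
    by_cases hEE : E = E₀
    · rw [hEE]; exact hE₀.resolve_left hE₀H
    · have hi : i ∉ E := fun hi => disjoint_left.1 (hdisj hE hE₀M hEE) hi hij.1
      have hE' := mem_compress.1 (hM hE)
      rw [if_neg (fun h => hi h.1)] at hE'
      exact hE'.2
  · intro F hF G hG hFG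
    rw [coe_image] at hF hG
    obtain ⟨E, hE, rfl⟩ := hF
    obtain ⟨E', hE', rfl⟩ := hG
    exact (disjoint_map _).2 (hdisj hE hE' fun h => hFG (h ▸ rfl))

end Compression

/-! ### Stable families -/

/-- `H` is closed under replacing an element of an edge by a smaller one. -/
def ShiftClosed {n : ℕ} (H : Finset (Finset (Fin n))) : Prop :=
  ∀ i j : Fin n, i < j → ∀ E ∈ H, j ∈ E → i ∉ E → insert i (E.erase j) ∈ H

/-- Total size of the labels occurring in the edges. -/
def labelWeight {n : ℕ} (H : Finset (Finset (Fin n))) : ℕ :=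
  ∑ E ∈ H, ∑ x ∈ E, (x : ℕ)

theorem sum_swapSet_lt {n : ℕ} {i j : Fin n} (hij : i < j) {E : Finset (Fin n)}
    (hj : j ∈ E) (hi : i ∉ E) : ∑ x ∈ swapSet i j E, (x : ℕ) < ∑ x ∈ E, (x : ℕ) := by
  rw [swapSet_of_mem_of_notMem hj hi, sum_insert (fun h => hi (mem_of_mem_erase h)),
    ← add_sum_erase E _ hj]
  exact Nat.add_lt_add_right hij _

theorem labelWeight_compress_lt {n : ℕ} {i j : Fin n} (hij : i < j)
    {H : Finset (Finset (Fin n))} {E : Finset (Fin n)} (hE : E ∈ H) (hj : j ∈ E)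
    (hi : i ∉ E) (hE' : insert i (E.erase j) ∉ H) :
    labelWeight (compress i j H) < labelWeight H := by
  have hnot : E ∉ compress i j H := by
    rw [mem_compress, if_neg (fun h => hi h.1), swapSet_of_mem_of_notMem hj hi]
    exact fun h => hE' h.2
  calc labelWeight (compress i j H)
      ≤ ∑ F ∈ H.image (compressEdge i j H), ∑ x ∈ F, (x : ℕ) :=
        sum_le_sum_of_subset (compress_subset_image i j H)
    _ = ∑ F ∈ H, ∑ x ∈ compressEdge i j H F, (x : ℕ) := sum_image (compressEdge_injOn i j H)
    _ < labelWeight H := by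
        refine sum_lt_sum (fun F hF => ?_) ⟨E, hE, ?_⟩
        · unfold compressEdge
          split_ifs with h
          · exact le_rfl
          · obtain ⟨hj', hi', -⟩ := of_mem_of_notMem_compress hF h
            exact (sum_swapSet_lt hij hj' hi').le
        · rw [compressEdge, if_neg hnot]
          exact sum_swapSet_lt hij hj hi

/-- Compressing as long as possible yields a shift-closed family with at least as many cliques. -/
theorem exists_shiftClosed {n k : ℕ} (r s : ℕ) (H : Finset (Finset (Fin n)))
    (hmatch : matchingLE H k) :
    ∃ H' : Finset (Finset (Fin n)), matchingLE H' k ∧ ShiftClosed H' ∧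
      (cliques r s H).card ≤ (cliques r s H').card := by
  induction hw : labelWeight H using Nat.strong_induction_on generalizing H with
  | _ w ih =>
    by_cases hst : ShiftClosed H
    · exact ⟨H, hmatch, hst, le_rfl⟩
    · unfold ShiftClosed at hst
      push Not at hst
      obtain ⟨i, j, hij, E, hE, hj, hi, hE'⟩ := hst
      obtain ⟨H', hm, hc, hle⟩ := ih _ (hw ▸ labelWeight_compress_lt hij hE hj hi hE')
        (compress i j H) (matchingLE_compress hmatch) rfl
      exact ⟨H', hm, hc, (card_cliques_le_compress i j r s H).trans hle⟩

/-- The elements of `E` with label less than `x`. -/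
def below {n : ℕ} (E : Finset (Fin n)) (x : ℕ) : Finset (Fin n) :=
  E.filter fun y => (y : ℕ) < x

theorem mem_below {n : ℕ} {E : Finset (Fin n)} {x : ℕ} {y : Fin n} :
    y ∈ below E x ↔ y ∈ E ∧ (y : ℕ) < x := mem_filter

theorem below_subset {n : ℕ} (E : Finset (Fin n)) (x : ℕ) : below E x ⊆ E := filter_subset _ _

/-- A shift-closed family is closed under passing to sets that are smaller coordinatewise. -/
theorem ShiftClosed.mem_of_dominated {n : ℕ} {H : Finset (Finset (Fin n))}
    (hH : ShiftClosed H) {F G : Finset (Fin n)} (hF : F ∈ H) (hcard : G.card = F.card)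
    (hdom : ∀ x, (below F x).card ≤ (below G x).card) : G ∈ H := by
  induction hd : (G \ F).card generalizing F with
  | zero =>
    rw [card_eq_zero, sdiff_eq_empty_iff_subset] at hd
    rwa [eq_of_subset_of_card_le hd hcard.ge]
  | succ d ih =>
    have hne : (G \ F).Nonempty := card_pos.1 (by omega)
    obtain ⟨i, hiGF, hmax⟩ := exists_max_image (G \ F) id hne
    obtain ⟨hiG, hiF⟩ := mem_sdiff.1 hiGF
    have hgt : ∀ y ∈ G, i < y → y ∈ F := fun y hy hiy => by
      by_contra hyF
      exact absurd (hmax y (mem_sdiff.2 ⟨hy, hyF⟩)) (not_le.2 hiy)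
    have hsplit : ∀ (E : Finset (Fin n)) (x : ℕ),
        (below E x).card + (E.filter fun y : Fin n => ¬ (y : ℕ) < x).card = E.card :=
      fun E x => card_filter_add_card_filter_not _
    obtain ⟨j, hj, hjG⟩ : ∃ j ∈ F.filter (fun y : Fin n => ¬ (y : ℕ) < i),
        j ∉ G.filter (fun y : Fin n => ¬ (y : ℕ) < i) := by
      by_contra hcon
      have h₁ : F.filter (fun y : Fin n => ¬ (y : ℕ) < i) ⊂ G.filter (fun y : Fin n => ¬ (y : ℕ) < i) :=
        ⟨fun y hy => by_contra fun h => hcon ⟨y, hy, h⟩, fun h => hiF (mem_filter.1 (h (mem_filter.2 ⟨hiG, lt_irrefl _⟩))).1⟩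
      have := card_lt_card h₁
      have := hsplit F i
      have := hsplit G i
      have := hdom i
      omega
    obtain ⟨hjF, hji⟩ := mem_filter.1 hj
    have hjG : j ∉ G := fun h => hjG (mem_filter.2 ⟨h, hji⟩)
    have hij : i < j := lt_of_le_of_ne (not_lt.1 hji) fun h => hiF (h ▸ hjF)
    have hiE : i ∉ F.erase j := fun h => hiF (mem_of_mem_erase h)
    have hcard' : (insert i (F.erase j)).card = F.card := by
      rw [card_insert_of_notMem hiE, card_erase_add_one hjF]
    refine ih (hH i j hij F hF hjF hiF) (hcard.trans hcard'.symm) (fun x => ?_) ?_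
    · by_cases hxi : (i : ℕ) < x
      · by_cases hjx : (j : ℕ) < x
        · have heq : below (insert i (F.erase j)) x = insert i ((below F x).erase j) := by
            ext y
            simp only [mem_below, mem_insert, mem_erase]
            constructor
            · rintro ⟨h | h, h'⟩
              · exact Or.inl h
              · exact Or.inr ⟨h.1, h.2, h'⟩
            · rintro (h | h)
              · exact ⟨Or.inl h, h ▸ hxi⟩
              · exact ⟨Or.inr ⟨h.1, h.2.1⟩, h.2.2⟩
          rw [heq, card_insert_of_notMem (fun h => hiF (mem_below.1 (mem_of_mem_erase h)).1),
            card_erase_add_one (mem_below.2 ⟨hjF, hjx⟩)]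
          exact hdom x
        · have h₁ : G.filter (fun y : Fin n => ¬ (y : ℕ) < x) ⊆
              (insert i (F.erase j)).filter (fun y : Fin n => ¬ (y : ℕ) < x) := by
            intro y hy
            obtain ⟨hyG, hyx⟩ := mem_filter.1 hy
            have hiy : i < y := Fin.lt_def.2 (by omega)
            exact mem_filter.2 ⟨mem_insert_of_mem (mem_erase.2
              ⟨fun h => hjG (h ▸ hyG), hgt y hyG hiy⟩), hyx⟩
          have := card_le_card h₁
          have := hsplit G x
          have := hsplit (insert i (F.erase j)) x
          omega
      · refine le_trans (card_le_card fun y hy => ?_) (hdom x)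
        rw [mem_below, mem_insert, mem_erase] at hy
        obtain ⟨rfl | h, h'⟩ := hy
        · exact absurd h' hxi
        · exact mem_below.2 ⟨h.2, h'⟩
    · have heq : G \ insert i (F.erase j) = (G \ F).erase i := by
        ext y
        simp only [mem_sdiff, mem_insert, mem_erase]
        constructor
        · rintro ⟨hy, h⟩
          refine ⟨fun h' => h (Or.inl h'), hy, fun hyF => h (Or.inr ⟨?_, hyF⟩)⟩
          exact fun h' => hjG (h' ▸ hy)
        · rintro ⟨hyi, hy, hyF⟩
          exact ⟨hy, fun h => h.elim hyi (fun h => hyF h.2)⟩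
      rw [heq, card_erase_of_mem hiGF]
      omega

/-- The set `{g 0, …, g (r - 1)}` as a subset of `Fin n`. -/
def valueSet (n r : ℕ) (g : ℕ → ℕ) : Finset (Fin n) :=
  univ.filter fun y => ∃ c < r, g c = y

theorem mem_valueSet {n r : ℕ} {g : ℕ → ℕ} {y : Fin n} :
    y ∈ valueSet n r g ↔ ∃ c < r, g c = y := by
  simp [valueSet]

theorem le_card_below_valueSet {n r t x : ℕ} {g : ℕ → ℕ} (htr : t ≤ r)
    (hn : ∀ c < r, g c < n) (hinj : ∀ c < r, ∀ c' < r, g c = g c' → c = c')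
    (hx : ∀ c < t, g c < x) : t ≤ (below (valueSet n r g) x).card := by
  have := card_le_card_of_injOn (s := (univ : Finset (Fin t)))
    (t := below (valueSet n r g) x)
    (fun c => ⟨g c, hn c (c.2.trans_le htr)⟩)
    (fun c _ => by
      rw [mem_coe, mem_below, mem_valueSet]
      exact ⟨⟨c, c.2.trans_le htr, rfl⟩, hx c c.2⟩)
    (fun c _ c' _ h => Fin.ext (hinj c (c.2.trans_le htr) c' (c'.2.trans_le htr)
      (by simpa using h)))
  simpa using this

theorem card_valueSet {n r : ℕ} {g : ℕ → ℕ} (hn : ∀ c < r, g c < n)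
    (hinj : ∀ c < r, ∀ c' < r, g c = g c' → c = c') : (valueSet n r g).card = r := by
  refine le_antisymm ?_ ((le_card_below_valueSet le_rfl hn hinj (x := n) hn).trans
    (card_le_card (below_subset _ _)))
  have hsub : (valueSet n r g).image (fun y : Fin n => (y : ℕ)) ⊆ (range r).image g := by
    intro y hy
    obtain ⟨z, hz, rfl⟩ := mem_image.1 hy
    obtain ⟨c, hc, h⟩ := mem_valueSet.1 hz
    exact mem_image.2 ⟨c, mem_range.2 hc, h⟩
  rw [← card_image_of_injective _ Fin.val_injective]
  exact (card_le_card hsub).trans (card_image_le.trans (card_range r).le)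

/-- A `(k + 1) × r` array of distinct labels whose rows are edges contradicts `ν(H) ≤ k`. -/
theorem not_matchingLE_of_array {n r k : ℕ} (hr : 0 < r) {H : Finset (Finset (Fin n))}
    (g : ℕ → ℕ → ℕ) (hn : ∀ v ≤ k, ∀ c < r, g v c < n)
    (hinj : ∀ v ≤ k, ∀ c < r, ∀ v' ≤ k, ∀ c' < r, g v c = g v' c' → v = v' ∧ c = c')
    (hH : ∀ v ≤ k, valueSet n r (g v) ∈ H) : ¬ matchingLE H k := by
  intro hmatch
  have hdisj : ∀ v ≤ k, ∀ v' ≤ k, v ≠ v' →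
      Disjoint (valueSet n r (g v)) (valueSet n r (g v')) := by
    intro v hv v' hv' hne
    refine disjoint_left.2 fun y hy hy' => ?_
    obtain ⟨c, hc, h⟩ := mem_valueSet.1 hy
    obtain ⟨c', hc', h'⟩ := mem_valueSet.1 hy'
    exact hne (hinj v hv c hc v' hv' c' hc' (h.trans h'.symm)).1
  have hle := hmatch ((range (k + 1)).image fun v => valueSet n r (g v)) ?_ ?_
  · rw [card_image_of_injOn, card_range] at hle
    · omega
    · intro v hv v' hv' h
      have hv : v ≤ k := by simpa [Nat.lt_succ_iff] using hv
      have hv' : v' ≤ k := by simpa [Nat.lt_succ_iff] using hv'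
      by_contra hne
      have hd := hdisj v hv v' hv' hne
      rw [show valueSet n r (g v) = valueSet n r (g v') from h, disjoint_self_iff_empty] at hd
      have : (⟨g v' 0, hn v' hv' 0 hr⟩ : Fin n) ∈ valueSet n r (g v') :=
        mem_valueSet.2 ⟨0, hr, rfl⟩
      simp [hd] at this
  · intro E hE
    obtain ⟨v, hv, rfl⟩ := mem_image.1 hE
    exact hH v (by simpa [Nat.lt_succ_iff] using hv)
  · intro E hE F hF hEF
    obtain ⟨v, hv, rfl⟩ := mem_image.1 hE
    obtain ⟨v', hv', rfl⟩ := mem_image.1 hF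
    exact hdisj v (by simpa [Nat.lt_succ_iff] using hv) v'
      (by simpa [Nat.lt_succ_iff] using hv') fun h => hEF (h ▸ rfl)

/-- Every edge of a shift-closed family with `ν(H) ≤ k` has, for some `j`, at least `j` elements
among the first `(k + 1) j - 1` vertices. -/
theorem ShiftClosed.exists_le_card_below {n r k : ℕ} (hr : 0 < r) (hnr : (k + 1) * r ≤ n)
    {H : Finset (Finset (Fin n))} (hH : ShiftClosed H) (hmatch : matchingLE H k)
    {F : Finset (Fin n)} (hF : F ∈ H) (hFr : F.card = r) :
    ∃ j, 1 ≤ j ∧ j ≤ r ∧ j ≤ (below F ((k + 1) * j - 1)).card := by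
  by_contra! hcon
  have hn : ∀ v ≤ k, ∀ c < r, c * (k + 1) + v < n := fun v hv c hc => by
    have : (c + 1) * (k + 1) ≤ r * (k + 1) := Nat.mul_le_mul_right _ hc
    nlinarith
  have hinj : ∀ v ≤ k, ∀ c < r, ∀ v' ≤ k, ∀ c' < r,
      c * (k + 1) + v = c' * (k + 1) + v' → v = v' ∧ c = c' := by
    intro v hv c _ v' hv' c' _ h
    have hc : c = c' := by
      have := congrArg (· / (k + 1)) h
      simpa [mul_comm _ (k + 1), Nat.mul_add_div, Nat.div_eq_of_lt (Nat.lt_succ_of_le hv),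
        Nat.div_eq_of_lt (Nat.lt_succ_of_le hv')] using this
    subst hc
    exact ⟨by omega, rfl⟩
  refine not_matchingLE_of_array hr (fun v c => c * (k + 1) + v) hn hinj (fun v hv => ?_) hmatch
  have hinj' : ∀ c < r, ∀ c' < r, c * (k + 1) + v = c' * (k + 1) + v → c = c' :=
    fun c hc c' hc' h => (hinj v hv c hc v hv c' hc' h).2
  refine hH.mem_of_dominated hF ((card_valueSet (hn v hv) hinj').trans hFr.symm) fun x => ?_
  have htr : (below F x).card ≤ r := hFr ▸ card_le_card (below_subset F x)
  refine le_card_below_valueSet htr (hn v hv) hinj' fun c hc => ?_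
  have hlt := hcon (below F x).card (by omega) htr
  have hx : (k + 1) * (below F x).card - 1 < x := by
    by_contra! hle
    refine absurd (card_le_card (fun y hy => ?_)) (not_le.2 hlt)
    rw [mem_below] at hy ⊢
    exact ⟨hy.1, hy.2.trans_le hle⟩
  have : (k + 1) * (c + 1) ≤ (k + 1) * (below F x).card := Nat.mul_le_mul_left _ hc
  have : (k + 1) * (c + 1) = c * (k + 1) + k + 1 := by ring
  omega

theorem exists_top_subset {n : ℕ} (S : Finset (Fin n)) {r : ℕ} (hr : r ≤ S.card) :
    ∃ F ⊆ S, F.card = r ∧ ∀ x ∈ S, x ∉ F → ∀ y ∈ F, x < y := by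
  induction r with
  | zero => exact ⟨∅, empty_subset _, card_empty, by simp⟩
  | succ r ih =>
    obtain ⟨F, hFS, hFr, hF⟩ := ih (by omega)
    have hne : (S \ F).Nonempty := card_pos.1 (by rw [card_sdiff_of_subset hFS]; omega)
    obtain ⟨m, hm, hmax⟩ := exists_max_image (S \ F) id hne
    obtain ⟨hmS, hmF⟩ := mem_sdiff.1 hm
    refine ⟨insert m F, insert_subset hmS hFS, by rw [card_insert_of_notMem hmF, hFr],
      fun x hx hxF y hy => ?_⟩
    rw [mem_insert, not_or] at hxF
    rcases mem_insert.1 hy with rfl | hy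
    · exact lt_of_le_of_ne (hmax x (mem_sdiff.2 ⟨hx, hxF.2⟩)) hxF.1
    · exact hF x hx hxF.2 y hy

/-- Every clique of a shift-closed family with `ν(H) ≤ k` is concentrated on an initial segment. -/
theorem ShiftClosed.exists_le_card_below_clique {n r k : ℕ} (hr : 0 < r)
    (hnr : (k + 1) * r ≤ n) {H : Finset (Finset (Fin n))} (hH : ShiftClosed H)
    (hmatch : matchingLE H k) {S : Finset (Fin n)} (hS : S ∈ cliques r (r + k - 1) H)
    (hk : 0 < k) :
    ∃ j, 1 ≤ j ∧ j ≤ r ∧ j + k - 1 ≤ (below S ((k + 1) * j - 1)).card := by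
  obtain ⟨hScard, hSH⟩ := mem_cliques.1 hS
  obtain ⟨F, hFS, hFr, hF⟩ := exists_top_subset S (r := r) (by omega)
  obtain ⟨j, hj1, hjr, hj⟩ := hH.exists_le_card_below hr hnr hmatch (hSH F hFS hFr) hFr
  refine ⟨j, hj1, hjr, ?_⟩
  obtain ⟨y, hy⟩ : (below F ((k + 1) * j - 1)).Nonempty := card_pos.1 (by omega)
  rw [mem_below] at hy
  have hsub : below F ((k + 1) * j - 1) ∪ (S \ F) ⊆ below S ((k + 1) * j - 1) := by
    intro x hx
    rcases mem_union.1 hx with hx | hx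
    · exact mem_below.2 ⟨hFS (mem_below.1 hx).1, (mem_below.1 hx).2⟩
    · rw [mem_sdiff] at hx
      exact mem_below.2 ⟨hx.1, (Fin.lt_def.1 (hF x hx.1 hx.2 y hy.1)).trans hy.2⟩
  have hle := card_le_card hsub
  rw [card_union_of_disjoint (disjoint_left.2 fun x hx hx' =>
    (mem_sdiff.1 hx').2 (mem_below.1 hx).1), card_sdiff_of_subset hFS] at hle
  omega

theorem card_below_univ {n x : ℕ} (hx : x ≤ n) : (below (univ : Finset (Fin n)) x).card = x := by
  simp [below, Fin.card_filter_val_lt, hx]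

/-- If some edge misses the first `k` vertices, every clique containing these `k` vertices
contains a further vertex among the first `(k + 1) r`. -/
theorem ShiftClosed.exists_mem_of_edge_disjoint {n r k : ℕ} (hr : 0 < r)
    (hnr : (k + 1) * r ≤ n) {H : Finset (Finset (Fin n))} (hH : ShiftClosed H)
    (hmatch : matchingLE H k) {E : Finset (Fin n)} (hE : E ∈ H) (hEr : E.card = r)
    (hEk : ∀ x ∈ E, k ≤ (x : ℕ)) {S : Finset (Fin n)} (hS : S ∈ cliques r (r + k - 1) H)
    (hSk : below univ k ⊆ S) : ∃ x ∈ S, k ≤ (x : ℕ) ∧ (x : ℕ) < (k + 1) * r := by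
  by_contra! hcon
  have hkn : k ≤ n := by nlinarith
  obtain ⟨hScard, hSH⟩ := mem_cliques.1 hS
  set g : ℕ → ℕ → ℕ := fun v c =>
    if v = k then k + c else if c = 0 then v else k + r + (c - 1) * k + v with hg
  have hbound : ∀ c < r, c ≠ 0 → (c - 1) * k + k ≤ (r - 1) * k := fun c hc hc0 => by
    have : (c - 1) * k + k = c * k := by
      obtain ⟨d, rfl⟩ := Nat.exists_eq_succ_of_ne_zero hc0
      simp; ring
    rw [this]
    exact Nat.mul_le_mul_right _ (by omega)
  have htot : k + r + (r - 1) * k = (k + 1) * r := by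
    obtain ⟨d, rfl⟩ := Nat.exists_eq_succ_of_ne_zero hr.ne'
    simp; ring
  have hlt : ∀ v ≤ k, ∀ c < r, g v c < (k + 1) * r := by
    intro v hv c hc
    simp only [hg]
    split_ifs with h₁ h₂
    · have := Nat.zero_le ((r - 1) * k); omega
    · have := Nat.zero_le ((r - 1) * k); omega
    · have := hbound c hc h₂; omega
  have hn : ∀ v ≤ k, ∀ c < r, g v c < n := fun v hv c hc => (hlt v hv c hc).trans_le hnr
  have hinj : ∀ v ≤ k, ∀ c < r, ∀ v' ≤ k, ∀ c' < r, g v c = g v' c' → v = v' ∧ c = c' := by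
    intro v hv c hc v' hv' c' hc' h
    simp only [hg] at h
    split_ifs at h with h₁ h₂ h₃ h₄ h₅ h₆ h₇ h₈
    all_goals try omega
    · have hvk : v < k := by omega
      have hvk' : v' < k := by omega
      have h' : k * (c - 1) + v = k * (c' - 1) + v' := by
        rw [mul_comm k, mul_comm k]; omega
      have hcc : c - 1 = c' - 1 := by
        have := congrArg (· / k) h'
        simpa [Nat.mul_add_div (by omega : k > 0), Nat.div_eq_of_lt hvk,
          Nat.div_eq_of_lt hvk'] using this
      rw [hcc] at h'
      omega
  refine not_matchingLE_of_array hr g hn hinj (fun v hv => ?_) hmatch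
  have hinj' : ∀ c < r, ∀ c' < r, g v c = g v c' → c = c' :=
    fun c hc c' hc' h => (hinj v hv c hc v hv c' hc' h).2
  have hcardv := card_valueSet (hn v hv) hinj'
  by_cases hvk : v = k
  · refine hH.mem_of_dominated hE (hcardv.trans hEr.symm) fun x => ?_
    refine le_card_below_valueSet (hEr ▸ card_le_card (below_subset E x)) (hn v hv) hinj'
      fun c hc => ?_
    have hle : (below E x).card ≤ x - k := by
      have h₁ : (below E x).image (fun y : Fin n => (y : ℕ)) ⊆ Ico k x := by
        intro y hy
        obtain ⟨z, hz, rfl⟩ := mem_image.1 hy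
        rw [mem_below] at hz
        exact mem_Ico.2 ⟨hEk z hz.1, hz.2⟩
      have := card_le_card h₁
      rwa [card_image_of_injective _ Fin.val_injective, Nat.card_Ico] at this
    simp only [hg, if_pos hvk]
    omega
  · have hvlt : v < k := by omega
    obtain ⟨R, hRS, hRr⟩ := exists_subset_card_eq
      (s := S \ below univ k) (n := r - 1) (by
        rw [card_sdiff_of_subset hSk, card_below_univ hkn]; omega)
    have hRbig : ∀ x ∈ R, (k + 1) * r ≤ (x : ℕ) := fun x hx => by
      obtain ⟨hxS, hxk⟩ := mem_sdiff.1 (hRS hx)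
      simp only [mem_below, mem_univ, true_and, not_lt] at hxk
      exact hcon x hxS hxk
    let w : Fin n := ⟨v, by omega⟩
    have hwR : w ∉ R := fun h => by
      have := hRbig w h
      have : w.1 < k := hvlt
      have : k + r + (r - 1) * k ≤ w.1 := by omega
      have := Nat.zero_le ((r - 1) * k)
      omega
    have hFr : (insert w R).card = r := by rw [card_insert_of_notMem hwR]; omega
    have hFH : insert w R ∈ H := hSH _ (insert_subset (hSk (mem_below.2 ⟨mem_univ _, hvlt⟩))
      (hRS.trans sdiff_subset)) hFr
    refine hH.mem_of_dominated hFH (hcardv.trans hFr.symm) fun x => ?_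
    refine le_card_below_valueSet (hFr ▸ card_le_card (below_subset _ x)) (hn v hv) hinj'
      fun c hc => ?_
    by_cases hx : x ≤ (k + 1) * r
    · have hsub : below (insert w R) x ⊆ ({w} : Finset (Fin n)).filter (fun y : Fin n => (y : ℕ) < x) := by
        intro y hy
        rw [mem_below, mem_insert] at hy
        obtain ⟨rfl | hyR, hyx⟩ := hy
        · exact mem_filter.2 ⟨mem_singleton_self _, hyx⟩
        · exact absurd hyx (not_lt.2 (hx.trans (hRbig y hyR)))
      have hle := card_le_card hsub
      rw [filter_singleton] at hle
      split_ifs at hle with hwx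
      · rw [card_singleton] at hle
        have hc0 : c = 0 := by omega
        simp only [hg, if_neg hvk, if_pos hc0]
        exact hwx
      · rw [card_empty] at hle
        omega
    · have hcr : c < r := hc.trans_le (hFr ▸ card_le_card (below_subset _ x))
      exact (hlt v hv c hcr).trans (not_le.1 hx)

/-! ### The numerical estimate -/

theorem mul_choose_pred_le {N a Q : ℕ} (ha : 0 < a) (hN : Q * a ≤ N) :
    Q * (N - 1).choose (a - 1) ≤ N.choose a := by
  obtain ⟨a, rfl⟩ := Nat.exists_eq_succ_of_ne_zero ha.ne'
  rcases Nat.eq_zero_or_pos N with rfl | hpos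
  · have : Q = 0 := by simpa using hN
    simp [this]
  obtain ⟨N, rfl⟩ := Nat.exists_eq_succ_of_ne_zero hpos.ne'
  simp only [Nat.succ_sub_one]
  have h := Nat.add_one_mul_choose_eq N a
  refine Nat.le_of_mul_le_mul_right (c := a + 1) ?_ (Nat.succ_pos a)
  calc Q * N.choose a * (a + 1) = (Q * (a + 1)) * N.choose a := by ring
    _ ≤ (N + 1) * N.choose a := Nat.mul_le_mul_right _ hN
    _ = (N + 1).choose (a + 1) * (a + 1) := h

theorem sum_le_of_two_mul_succ_le {t : ℕ → ℕ} {m : ℕ}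
    (h : ∀ i, 1 ≤ i → i < m → 2 * t (i + 1) ≤ t i) : ∑ i ∈ Icc 1 m, t i ≤ 2 * t 1 := by
  rcases Nat.eq_zero_or_pos m with rfl | hm
  · simp
  suffices H : ∀ l, 1 ≤ l → l ≤ m → ∑ i ∈ Icc 1 l, t i + t l ≤ 2 * t 1 by
    have := H m hm le_rfl; omega
  intro l hl
  induction l, hl using Nat.le_induction with
  | base => intro _; simp; omega
  | succ l hl ih =>
    intro hlm
    rw [sum_Icc_succ_top (by omega)]
    have := ih (by omega)
    have := h l hl (by omega)
    omega

theorem clique_estimate {n k r : ℕ} (hk : 0 < k) (hr : 2 ≤ r)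
    (hn : 4 * k * (2 * r) ^ (k + 1) ≤ n) :
    ((k + 1) * r - k) * (n - (k + 1)).choose (r - 2) +
      ∑ i ∈ Icc 1 (r - 1), ((k + 1) * (i + 1) - 1).choose (i + k) *
        (n - (i + k)).choose (r - 1 - i) ≤ (n - k).choose (r - 1) := by
  set B : ℕ → ℕ := fun i => (n - (i + k)).choose (r - 1 - i) with hB
  have hpow : 4 ^ k ≤ (2 * r) ^ k := Nat.pow_le_pow_left (by omega) k
  have hpos : 0 < 4 ^ k := by positivity
  have hbig : 8 * k * r * 4 ^ k ≤ n := by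
    calc 8 * k * r * 4 ^ k ≤ 8 * k * r * (2 * r) ^ k := Nat.mul_le_mul_left _ hpow
      _ = 4 * k * (2 * r) ^ (k + 1) := by ring
      _ ≤ n := hn
  have hbig' : 16 * k * (r * r) ≤ n := by
    have : 2 * r ≤ (2 * r) ^ k := Nat.le_self_pow hk.ne' _
    calc 16 * k * (r * r) = 8 * k * r * (2 * r) := by ring
      _ ≤ 8 * k * r * (2 * r) ^ k := Nat.mul_le_mul_left _ this
      _ = 4 * k * (2 * r) ^ (k + 1) := by ring
      _ ≤ n := hn
  have hstep : ∀ i, i < r - 1 → 6 * k * 4 ^ k * B (i + 1) ≤ B i := by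
    intro i hi
    have h := mul_choose_pred_le (N := n - (i + k)) (a := r - 1 - i) (Q := 6 * k * 4 ^ k)
      (by omega) (by
        have h₁ : 6 * k * 4 ^ k * (r - 1 - i) ≤ 6 * k * 4 ^ k * r :=
          Nat.mul_le_mul_left _ (by omega)
        have h₂ : i + k ≤ 2 * k * r * 4 ^ k := by
          have : r + k ≤ 2 * k * r := by nlinarith
          have : i + k ≤ 2 * k * r := by omega
          nlinarith
        have h₃ : 6 * k * 4 ^ k * r + 2 * k * r * 4 ^ k = 8 * k * r * 4 ^ k := by ring
        omega)
    have e₁ : n - (i + 1 + k) = n - (i + k) - 1 := by omega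
    have e₂ : r - 1 - (i + 1) = r - 1 - i - 1 := by omega
    simp only [hB, e₁, e₂]
    exact h
  have hfirst : 3 * (((k + 1) * r - k) * B 1) ≤ B 0 := by
    have h := mul_choose_pred_le (N := n - k) (a := r - 1) (Q := 6 * k * r) (by omega) (by
        have h₁ : 6 * k * r * (r - 1) ≤ 6 * k * r * r := Nat.mul_le_mul_left _ (by omega)
        have h₂ : k ≤ k * (r * r) := Nat.le_mul_of_pos_right _ (by nlinarith)
        have h₃ : 6 * k * r * r = 6 * (k * (r * r)) := by ring
        have h₄ : 16 * k * (r * r) = 16 * (k * (r * r)) := by ring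
        omega)
    have hB1 : B 1 = (n - k - 1).choose (r - 1 - 1) := by
      simp only [hB, show n - (1 + k) = n - k - 1 by omega]
    have hB0 : B 0 = (n - k).choose (r - 1) := by simp [hB]
    rw [hB0, hB1]
    refine le_trans ?_ h
    rw [← mul_assoc]
    refine Nat.mul_le_mul_right _ ?_
    have : (k + 1) * r ≤ 2 * (k * r) := by nlinarith
    have : 6 * k * r = 6 * (k * r) := by ring
    omega
  set t : ℕ → ℕ := fun i => 2 ^ ((k + 1) * i + k) * B i with ht
  have htstep : ∀ i, i < r - 1 → 3 * 2 ^ k * t (i + 1) ≤ t i := by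
    intro i hi
    have h4 : (4 : ℕ) ^ k = 2 ^ k * 2 ^ k := by rw [← mul_pow]; norm_num
    calc 3 * 2 ^ k * t (i + 1)
        = 2 ^ ((k + 1) * i + k) * (6 * 1 * 4 ^ k * B (i + 1)) := by
          simp only [ht, h4]; ring
      _ ≤ 2 ^ ((k + 1) * i + k) * (6 * k * 4 ^ k * B (i + 1)) := by gcongr; exact hk
      _ ≤ t i := Nat.mul_le_mul_left _ (hstep i hi)
  have ht1 : 3 * t 1 ≤ B 0 := by
    have h := htstep 0 (by omega)
    have h0 : t 0 = 2 ^ k * B 0 := by simp [ht]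
    rw [h0, zero_add] at h
    refine le_of_mul_le_mul_left (a := 2 ^ k) ?_ (by positivity)
    linarith
  have hsum : ∑ i ∈ Icc 1 (r - 1), t i ≤ 2 * t 1 := by
    refine sum_le_of_two_mul_succ_le fun i _ hi => le_trans ?_ (htstep i hi)
    have : 1 ≤ 2 ^ k := Nat.one_le_two_pow
    exact Nat.mul_le_mul_right _ (by omega)
  have hterm : ∑ i ∈ Icc 1 (r - 1), ((k + 1) * (i + 1) - 1).choose (i + k) *
        (n - (i + k)).choose (r - 1 - i) ≤ ∑ i ∈ Icc 1 (r - 1), t i := by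
    refine sum_le_sum fun i _ => Nat.mul_le_mul_right _ ?_
    have : (k + 1) * (i + 1) - 1 = (k + 1) * i + k := by
      rw [mul_add]; omega
    rw [this]
    exact Nat.choose_le_two_pow _ _
  have hB0 : B 0 = (n - k).choose (r - 1) := by simp [hB]
  have hB1 : B 1 = (n - (k + 1)).choose (r - 2) := by simp only [hB, add_comm 1 k]; rfl
  rw [hB0, hB1] at hfirst
  rw [hB0] at ht1
  omega

/-! ### The main bound -/

theorem ShiftClosed.card_cliques_le {n k r : ℕ} (hk : 0 < k) (hr : 0 < r)
    (hn : 4 * k * (2 * r) ^ (k + 1) ≤ n) {H : Finset (Finset (Fin n))} (hH : ShiftClosed H)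
    (hmatch : matchingLE H k) :
    (cliques r (r + k - 1) H).card ≤ (n - k).choose (r - 1) := by
  have hnr : (k + 1) * r ≤ n := by
    have : 2 * r ≤ (2 * r) ^ (k + 1) := Nat.le_self_pow (by omega) _
    calc (k + 1) * r ≤ 4 * k * (2 * r) := by nlinarith
      _ ≤ 4 * k * (2 * r) ^ (k + 1) := Nat.mul_le_mul_left _ this
      _ ≤ n := hn
  have hkn : k ≤ n := by nlinarith
  set A : Finset (Fin n) := below univ k with hA
  have hAcard : A.card = k := card_below_univ hkn
  by_cases hall : ∀ S ∈ cliques r (r + k - 1) H, A ⊆ S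
  · have hsub : cliques r (r + k - 1) H ⊆
        (univ.powersetCard (r + k - 1)).filter (fun S => A ⊆ S) := fun S hS =>
      mem_filter.2 ⟨mem_powersetCard.2 ⟨subset_univ _, (mem_cliques.1 hS).1⟩, hall S hS⟩
    refine (card_le_card hsub).trans ?_
    rw [card_powersetCard_filter_superset A (by omega), hAcard, Fintype.card_fin,
      show r + k - 1 - k = r - 1 by omega]
  push Not at hall
  obtain ⟨S₀, hS₀, hAS₀⟩ := hall
  obtain ⟨hS₀card, hS₀H⟩ := mem_cliques.1 hS₀
  have hfew : ∀ S : Finset (Fin n), ¬ A ⊆ S → (below S k).card < k := fun S hS => by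
    have hss : below S k ⊂ A := by
      refine ⟨fun x hx => mem_below.2 ⟨mem_univ _, (mem_below.1 hx).2⟩, fun h => hS ?_⟩
      exact h.trans (below_subset S k)
    exact (card_lt_card hss).trans_eq hAcard
  have hspread : ∀ S ∈ cliques r (r + k - 1) H, ¬ A ⊆ S →
      ∃ i ∈ Icc 1 (r - 1), i + k ≤ (below S ((k + 1) * (i + 1) - 1)).card := by
    intro S hS hAS
    obtain ⟨j, hj1, hjr, hj⟩ := hH.exists_le_card_below_clique hr hnr hmatch hS hk
    have hj2 : j ≠ 1 := by
      rintro rfl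
      have := hfew S hAS
      simp at hj
      omega
    refine ⟨j - 1, mem_Icc.2 ⟨by omega, by omega⟩, ?_⟩
    rw [show j - 1 + 1 = j by omega]
    omega
  have hr2 : 2 ≤ r := by
    obtain ⟨i, hi, -⟩ := hspread S₀ hS₀ hAS₀
    rw [mem_Icc] at hi
    omega
  obtain ⟨E, hES, hEr⟩ := exists_subset_card_eq (s := S₀ \ below S₀ k) (n := r) (by
    have := hfew S₀ hAS₀
    rw [card_sdiff_of_subset (below_subset _ _)]; omega)
  have hEH : E ∈ H := hS₀H E (hES.trans sdiff_subset) hEr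
  have hEk : ∀ x ∈ E, k ≤ (x : ℕ) := fun x hx => by
    have h := mem_sdiff.1 (hES hx)
    by_contra hlt
    exact h.2 (mem_below.2 ⟨h.1, not_le.1 hlt⟩)
  set D : Finset (Fin n) := below univ ((k + 1) * r) \ A with hD
  have hDcard : D.card = (k + 1) * r - k := by
    rw [hD, card_sdiff_of_subset, hAcard, card_below_univ hnr]
    intro x hx
    rw [mem_below] at hx ⊢
    exact ⟨hx.1, hx.2.trans_le (by nlinarith)⟩
  have hcover : cliques r (r + k - 1) H ⊆
      D.biUnion (fun x => (univ.powersetCard (r + k - 1)).filter (fun S => insert x A ⊆ S)) ∪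
      (Icc 1 (r - 1)).biUnion (fun i => (univ.powersetCard (r + k - 1)).filter
        (fun S => i + k ≤ (S ∩ below univ ((k + 1) * (i + 1) - 1)).card)) := by
    intro S hS
    have hSs : S ∈ univ.powersetCard (r + k - 1) :=
      mem_powersetCard.2 ⟨subset_univ _, (mem_cliques.1 hS).1⟩
    by_cases hAS : A ⊆ S
    · obtain ⟨x, hxS, hkx, hx⟩ :=
        hH.exists_mem_of_edge_disjoint hr hnr hmatch hEH hEr hEk hS hAS
      refine mem_union_left _ (mem_biUnion.2 ⟨x, ?_, mem_filter.2 ⟨hSs, insert_subset hxS hAS⟩⟩)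
      rw [hD, mem_sdiff, hA, mem_below, mem_below]
      exact ⟨⟨mem_univ _, hx⟩, fun h => absurd h.2 (not_lt.2 hkx)⟩
    · obtain ⟨i, hi, hle⟩ := hspread S hS hAS
      refine mem_union_right _ (mem_biUnion.2 ⟨i, hi, mem_filter.2 ⟨hSs, ?_⟩⟩)
      refine hle.trans (card_le_card fun x hx => ?_)
      rw [mem_below] at hx
      exact mem_inter.2 ⟨hx.1, mem_below.2 ⟨mem_univ _, hx.2⟩⟩
  refine (card_le_card hcover).trans ((card_union_le _ _).trans
    (le_trans (Nat.add_le_add ?_ ?_) (clique_estimate hk hr2 hn)))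
  · rw [← hDcard]
    refine card_biUnion_le_card_mul _ _ _ fun x hx => ?_
    have hxA : x ∉ A := (mem_sdiff.1 hx).2
    have hcard : (insert x A).card = k + 1 := by rw [card_insert_of_notMem hxA, hAcard]
    rw [card_powersetCard_filter_superset _ (by omega), hcard, Fintype.card_fin,
      show r + k - 1 - (k + 1) = r - 2 by omega]
  · refine card_biUnion_le.trans (sum_le_sum fun i hi => ?_)
    rw [mem_Icc] at hi
    refine (card_powersetCard_filter_inter_le _ (by omega)).trans ?_
    rw [Fintype.card_fin, card_below_univ,
      show r + k - 1 - (i + k) = r - 1 - i by omega]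
    exact (Nat.sub_le _ _).trans ((Nat.mul_le_mul_left _ (by omega)).trans hnr)

theorem choose_le_cliqueCount_Fnka {n k r : ℕ} (hr : 0 < r) (hkn : k ≤ n) :
    (n - k).choose (r - 1) ≤ cliqueCount r (r + k - 1) (Fnka n k r 1) := by
  have hAcard : (below (univ : Finset (Fin n)) k).card = k := card_below_univ hkn
  have h := card_powersetCard_filter_superset (below (univ : Finset (Fin n)) k)
    (s := r + k - 1) (by omega)
  rw [hAcard, Fintype.card_fin, show r + k - 1 - k = r - 1 by omega] at h
  rw [← h]
  refine card_le_card fun S hS => ?_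
  obtain ⟨hSs, hAS⟩ := mem_filter.1 hS
  refine mem_filter.2 ⟨hSs, fun E hE => ?_⟩
  obtain ⟨hES, hEr⟩ := mem_powersetCard.1 hE
  refine mem_filter.2 ⟨mem_powersetCard.2 ⟨subset_univ _, hEr⟩, ?_⟩
  rw [Nat.one_le_iff_ne_zero, Ne, card_eq_zero]
  intro hempty
  have hsub : E ⊆ S \ below univ k := fun x hx => by
    refine mem_sdiff.2 ⟨hES hx, fun hxk => ?_⟩
    have : x ∈ E.filter (fun x : Fin n => (x : ℕ) < 1 * k + 1 - 1) :=
      mem_filter.2 ⟨hx, by simpa using (mem_below.1 hxk).2⟩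
    rw [hempty] at this
    exact notMem_empty _ this
  have := card_le_card hsub
  rw [card_sdiff_of_subset hAS, (mem_powersetCard.1 hSs).2, hEr, hAcard] at this
  omega

/-! ### Relabelling the vertices -/

section Relabel

variable {V W : Type*} (e : V ≃ W)

theorem matchingLE_map {H : Finset (Finset V)} {k : ℕ} (h : matchingLE H k) :
    matchingLE (H.map e.finsetCongr.toEmbedding) k := by
  intro M hM hdisj
  have h' := h (M.map e.finsetCongr.symm.toEmbedding) ?_ ?_
  · simpa using h'
  · intro E hE
    rw [mem_map_equiv] at hE
    have := hM hE
    rw [mem_map_equiv] at this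
    simpa [map_map] using this
  · intro E hE F hF hEF
    rw [mem_coe, mem_map_equiv] at hE hF
    have := hdisj hE hF (fun h => hEF (by simpa using h))
    simpa using this

theorem card_cliques_map [Fintype V] [DecidableEq V] [Fintype W] [DecidableEq W] (r s : ℕ)
    (H : Finset (Finset V)) :
    (cliques r s H).card ≤ (cliques r s (H.map e.finsetCongr.toEmbedding)).card := by
  rw [← card_map e.finsetCongr.toEmbedding]
  refine card_le_card fun S hS => ?_
  rw [mem_map_equiv, mem_cliques] at hS
  refine mem_cliques.2 ⟨by simpa using hS.1, fun E hE hEr => ?_⟩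
  rw [mem_map_equiv]
  refine hS.2 _ ?_ (by simpa using hEr)
  simpa using hE

end Relabel

/-- Lemma 2.2 (base case of the induction). -/
theorem max_cliques_base_case {V : Type*} [Fintype V] [DecidableEq V] {n r s : ℕ}
    (hr0 : 0 < r) (hs0 : 0 < s) (hrs : r ≤ s)
    (hcard : Fintype.card V = n)
    (H : Finset (Finset V)) (hunif : ∀ E ∈ H, E.card = r)
    (hmatch : matchingLE H (s - r + 1))
    (hn : 4 * (s - r + 1) * (Real.exp 1 * r) ^ (s - r + 2) ≤ (n : ℝ)) :
    cliqueCount r s H ≤ cliqueCount r s (Fnka n (s - r + 1) r 1) := by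
  obtain ⟨l, rfl⟩ := Nat.exists_eq_add_of_le hrs
  rw [show r + l - r = l by omega] at *
  have hnat : 4 * (l + 1) * (2 * r) ^ (l + 1 + 1) ≤ n := by
    have he : (2 : ℝ) ≤ Real.exp 1 := by
      have := Real.add_one_le_exp (1 : ℝ); linarith
    have hle : (4 : ℝ) * (l + 1) * (2 * r) ^ (l + 2) ≤ n := by
      refine le_trans ?_ hn
      push_cast
      rw [show (r : ℝ) + l - r + 1 = l + 1 by ring]
      gcongr
    exact_mod_cast hle
  have hln : l + 1 ≤ n := by
    have : 1 ≤ (2 * r) ^ (l + 1 + 1) := Nat.one_le_pow _ _ (by omega)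
    nlinarith
  obtain ⟨e⟩ : Nonempty (V ≃ Fin n) := ⟨Fintype.equivFinOfCardEq hcard⟩
  obtain ⟨H', hmatch', hclosed, hle⟩ := exists_shiftClosed r (r + l)
    (H.map e.finsetCongr.toEmbedding) (matchingLE_map e hmatch)
  have hmain := hclosed.card_cliques_le (Nat.succ_pos l) hr0 hnat hmatch'
  rw [show r + (l + 1) - 1 = r + l by omega] at hmain
  have hF := choose_le_cliqueCount_Fnka hr0 hln
  rw [show r + (l + 1) - 1 = r + l by omega] at hF
  exact (card_cliques_map e r (r + l) H).trans (hle.trans (hmain.trans hF))
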